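/- There is no strongly regular graph with parameters (v, k, λ, μ) = (23276, 1330, 372, 58). -/

import Mathlib

namespace SimpleGraph

open Finset

/-- Vertices of the local graph at `x` that are equal or adjacent to `z`. -/
def localBall {V : Type*} [Fintype V] [DecidableEq V] (G : SimpleGraph V)
    [DecidableRel G.Adj] (x z : V) : Finset V :=
  insert z (G.neighborFinset x ∩ G.neighborFinset z)

/-- Independent sets in the local graph at `x`. -/
def IsLocalCoclique {V : Type*} (G : SimpleGraph V) (x : V) (T : Finset V) : Prop :=
  (∀ t ∈ T, G.Adj x t) ∧ ∀ s ∈ T, ∀ t ∈ T, ¬ G.Adj s t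

lemma IsLocalCoclique.mono {V : Type*} {G : SimpleGraph V} {x : V} {S T : Finset V}
    (hT : IsLocalCoclique G x T) (hST : S ⊆ T) :
    IsLocalCoclique G x S :=
  ⟨fun t ht ↦ hT.1 t (hST ht), fun s hs t ht ↦ hT.2 s (hST hs) t (hST ht)⟩

end SimpleGraph

open Finset in
/-- A strongly regular graph with parameters `(23276, 1330, 372, 58)` has smallest eigenvalue at
least `-4`. -/
lemma SimpleGraph.IsSRGWith.quadraticForm_nonneg {V : Type*} [Fintype V] [DecidableEq V]
    {G : SimpleGraph V} [DecidableRel G.Adj] (h : G.IsSRGWith 23276 1330 372 58) (x : V → ℤ) :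
    0 ≤ ∑ u, x u * (4 * x u + ∑ v ∈ G.neighborFinset u, x v) := by
  set A := G.adjMatrix ℤ with hA
  set w : V → ℤ := fun u ↦ 4 * x u + ∑ v ∈ G.neighborFinset u, x v with hw
  have hAx : ∀ u, (A.mulVec x) u = ∑ v ∈ G.neighborFinset u, x v := fun u ↦ by
    simp [hA, SimpleGraph.adjMatrix_mulVec_apply]
  have hwA : w = A.mulVec x + (4 : ℤ) • x := by
    funext u
    simp [hw, hAx, add_comm]
  have hsq : A ^ 2 = (1272 : ℤ) • (1 : Matrix V V ℤ) + (314 : ℤ) • A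
      + (58 : ℤ) • (Matrix.of 1 : Matrix V V ℤ) := by
    have h1 := h.matrix_eq (α := ℤ)
    have h2 := SimpleGraph.one_add_adjMatrix_add_compl_adjMatrix_eq_of_one (α := ℤ) (G := G)
    rw [← h2, h1, SimpleGraph.compl_adjMatrix_eq_adjMatrix_compl]
    module
  have hsum : ∑ u, w u = 1334 * ∑ u, x u := by
    simp only [hw, sum_add_distrib, ← mul_sum]
    have : ∑ u, ∑ v ∈ G.neighborFinset u, x v = 1330 * ∑ u, x u := by
      rw [sum_comm' (t' := univ) (s' := fun v ↦ G.neighborFinset v)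
        (by intro a b; simp [G.adj_comm]), mul_sum]
      refine sum_congr rfl fun u _ ↦ ?_
      simp [h.regular.degree_eq]
    rw [this]
    ring
  have hAA : A.mulVec (A.mulVec x) = fun u ↦ 1272 * x u + 314 * (A.mulVec x) u + 58 * ∑ v, x v := by
    rw [Matrix.mulVec_mulVec, ← sq, hsq]
    funext u
    rw [Matrix.add_mulVec, Matrix.add_mulVec, Matrix.smul_mulVec, Matrix.smul_mulVec,
      Matrix.smul_mulVec, Matrix.one_mulVec]
    simp [Matrix.mulVec, dotProduct]
  have hsymm : ∑ u, (A.mulVec x) u * (A.mulVec x) u = ∑ u, x u * (A.mulVec (A.mulVec x)) u := by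
    change (A.mulVec x) ⬝ᵥ (A.mulVec x) = x ⬝ᵥ (A.mulVec (A.mulVec x))
    rw [Matrix.dotProduct_mulVec x, ← Matrix.mulVec_transpose, SimpleGraph.transpose_adjMatrix]
  have hww : ∑ u, w u ^ 2 = 322 * ∑ u, x u * w u + 58 * (∑ u, x u) ^ 2 := by
    have e1 : ∑ u, w u ^ 2 = ∑ u, (A.mulVec x) u * (A.mulVec x) u
        + ∑ u, (8 * (x u * (A.mulVec x) u) + 16 * x u ^ 2) := by
      rw [← sum_add_distrib]
      refine sum_congr rfl fun u _ ↦ ?_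
      simp [hwA]
      ring
    rw [sq (∑ u, x u), sum_mul, mul_sum univ _ (322 : ℤ), mul_sum univ _ (58 : ℤ),
      ← sum_add_distrib, e1, hsymm, hAA, ← sum_add_distrib]
    refine sum_congr rfl fun u _ ↦ ?_
    simp [hwA]
    ring
  have hcs := sq_sum_le_card_mul_sum_sq (s := univ) (f := w)
  rw [card_univ, h.card, hsum, hww] at hcs
  change 0 ≤ ∑ u, x u * w u
  push_cast at hcs
  nlinarith [sq_nonneg (∑ u, x u)]

namespace SimpleGraph.IsSRGWith

open Finset

variable {V : Type*} [Fintype V] [DecidableEq V] {G : SimpleGraph V} [DecidableRel G.Adj]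

lemma card_inter_of_adj {n k l m : ℕ} (h : G.IsSRGWith n k l m) {u v : V} (huv : G.Adj u v) :
    #(G.neighborFinset u ∩ G.neighborFinset v) = l := by
  rw [← h.of_adj u v huv, ← Set.toFinset_card]
  congr 1
  ext
  simp [mem_commonNeighbors]

lemma card_inter_of_not_adj {n k l m : ℕ} (h : G.IsSRGWith n k l m) {u v : V} (hne : u ≠ v)
    (huv : ¬ G.Adj u v) : #(G.neighborFinset u ∩ G.neighborFinset v) = m := by
  rw [← h.of_not_adj hne huv, ← Set.toFinset_card]
  congr 1
  ext
  simp [mem_commonNeighbors]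

/-- The quadratic form inequality, evaluated at the worst vector supported on a clique and one
further vertex. -/
lemma clique_inequality (h : G.IsSRGWith 23276 1330 372 58) {C : Finset V}
    (hC : G.IsClique (C : Set V)) {y : V} (hy : y ∉ C) {a c : ℤ}
    (ha : a = #(C ∩ G.neighborFinset y)) (hc : c = #C) :
    0 ≤ 4 * a * (c - a + 3) * (12 * (c + 3) - a * (c - a + 3)) := by
  set N := C ∩ G.neighborFinset y with hN
  set M := C \ G.neighborFinset y with hM
  have hMc : (#M : ℤ) = c - a := by
    have := card_sdiff_add_card_inter C (G.neighborFinset y)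
    rw [ha, hc, ← this]
    push_cast
    ring
  obtain ⟨p, q, r, hp, hq, hr⟩ : ∃ p q r : ℤ, p = a * (c - a + 3) ∧ q = -4 * (c - a + 3) ∧
    r = 4 * a := ⟨_, _, _, rfl, rfl, rfl⟩
  set x : V → ℤ := fun v ↦ if v = y then p else if v ∈ N then q else if v ∈ M then r else 0 with hx
  have hyN : y ∉ N := by simp [hN, hy]
  have hyM : y ∉ M := by simp [hM, hy]
  have hNM : Disjoint N M := by
    rw [Finset.disjoint_left]
    intro u hu hu'
    simp only [hN, hM, mem_inter, mem_sdiff] at hu hu'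
    exact hu'.2 hu.2
  have hsupp : ∀ F : V → ℤ, ∑ u, x u * F u = p * F y + q * ∑ u ∈ N, F u + r * ∑ u ∈ M, F u := by
    intro F
    have : ∀ u, x u * F u = (if u = y then p * F u else 0) + (if u ∈ N then q * F u else 0)
        + (if u ∈ M then r * F u else 0) := by
      intro u
      by_cases h1 : u = y
      · subst h1
        simp [hx, hyN, hyM]
      · by_cases h2 : u ∈ N
        · simp [hx, h1, h2, Finset.disjoint_left.1 hNM h2]
        · simp [hx, h1, h2]
    simp only [this, sum_add_distrib, mul_sum]
    simp
  have hnbr : ∀ u, ∑ v ∈ G.neighborFinset u, x v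
      = p * (if G.Adj u y then 1 else 0) + q * #(N ∩ G.neighborFinset u)
        + r * #(M ∩ G.neighborFinset u) := by
    intro u
    have e : ∑ v ∈ G.neighborFinset u, x v = ∑ v, x v * (if G.Adj u v then 1 else 0) := by
      simp [← sum_filter, neighborFinset_eq_filter]
    rw [e, hsupp]
    simp [← filter_mem_eq_inter]
  have hcl : ∀ u ∈ C, ∀ v ∈ C, u ≠ v → G.Adj u v := fun u hu v hv ↦ hC hu hv
  have hQ := h.quadraticForm_nonneg x
  rw [hsupp] at hQ
  have hFy : 4 * x y + ∑ v ∈ G.neighborFinset y, x v = 4 * p + q * a := by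
    have e1 : N ∩ G.neighborFinset y = N := by simp [hN]
    have e2 : M ∩ G.neighborFinset y = ∅ := by simp [hM]
    rw [hnbr, e1, e2, ← ha]
    simp [hx]
  have hFN : ∀ u ∈ N, 4 * x u + ∑ v ∈ G.neighborFinset u, x v
      = 4 * q + p + q * (a - 1) + r * (c - a) := by
    intro u hu
    have huC : u ∈ C := (mem_inter.1 hu).1
    have huy : G.Adj u y := by simpa [hN, G.adj_comm, huC] using hu
    have e1 : N ∩ G.neighborFinset u = N.erase u := by
      ext v
      simp only [mem_inter, mem_neighborFinset, mem_erase]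
      exact ⟨fun hv ↦ ⟨hv.2.ne', hv.1⟩,
        fun hv ↦ ⟨hv.2, hcl u huC v (mem_inter.1 hv.2).1 hv.1.symm⟩⟩
    have e2 : M ∩ G.neighborFinset u = M := by
      rw [inter_eq_left]
      intro v hv
      rw [mem_neighborFinset]
      refine hcl u huC v (mem_sdiff.1 hv).1 ?_
      rintro rfl
      exact Finset.disjoint_left.1 hNM hu hv
    have e3 : (#(N.erase u) : ℤ) = a - 1 := by
      rw [cast_card_erase_of_mem hu, ha]
    have e4 : x u = q := by simp [hx, huy.ne, hu]
    rw [hnbr, e1, e2, e3, e4, hMc]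
    simp [huy]
    ring
  have hFM : ∀ u ∈ M, 4 * x u + ∑ v ∈ G.neighborFinset u, x v
      = 4 * r + q * a + r * (c - a - 1) := by
    intro u hu
    have huC : u ∈ C := (mem_sdiff.1 hu).1
    have huy : ¬ G.Adj u y := by simpa [hM, G.adj_comm, huC] using hu
    have huy' : u ≠ y := by rintro rfl; exact hy huC
    have e1 : M ∩ G.neighborFinset u = M.erase u := by
      ext v
      simp only [mem_inter, mem_neighborFinset, mem_erase]
      exact ⟨fun hv ↦ ⟨hv.2.ne', hv.1⟩,
        fun hv ↦ ⟨hv.2, hcl u huC v (mem_sdiff.1 hv.2).1 hv.1.symm⟩⟩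
    have e2 : N ∩ G.neighborFinset u = N := by
      rw [inter_eq_left]
      intro v hv
      rw [mem_neighborFinset]
      refine hcl u huC v (mem_inter.1 hv).1 ?_
      rintro rfl
      exact Finset.disjoint_left.1 hNM hv hu
    have e3 : (#(M.erase u) : ℤ) = c - a - 1 := by
      rw [cast_card_erase_of_mem hu, hMc]
    have e4 : x u = r := by simp [hx, huy', hu, Finset.disjoint_right.1 hNM hu]
    rw [hnbr, e1, e2, e3, e4, ← ha]
    simp [huy]
    ring
  rw [hFy, sum_congr rfl hFN, sum_congr rfl hFM] at hQ
  simp only [sum_const, nsmul_eq_mul, hMc, ← ha] at hQ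
  subst hp hq hr
  linarith

/-- An outside vertex of a large maximal clique has few neighbours in it. -/
lemma card_inter_neighborFinset_le (h : G.IsSRGWith 23276 1330 372 58) {C : Finset V}
    (hC : Maximal (fun s : Finset V ↦ G.IsClique (s : Set V)) C) (hcard : 146 ≤ #C) {y : V}
    (hy : y ∉ C) : #(C ∩ G.neighborFinset y) ≤ 13 := by
  obtain ⟨z, hz, hyz⟩ : ∃ z ∈ C, ¬ G.Adj y z := by
    by_contra! hall
    have hins : G.IsClique ((insert y C : Finset V) : Set V) := by
      rw [coe_insert, isClique_insert]
      exact ⟨hC.prop, fun b hb _ ↦ hall b hb⟩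
    exact hy (hC.le_of_ge hins (subset_insert y C) (mem_insert_self y C))
  have hne : y ≠ z := by rintro rfl; exact hy hz
  have h58 : #(C ∩ G.neighborFinset y) ≤ 58 := by
    rw [← h.card_inter_of_not_adj hne hyz]
    refine card_le_card fun u hu ↦ ?_
    simp only [mem_inter, mem_neighborFinset] at hu ⊢
    refine ⟨hu.2, hC.prop hz hu.1 ?_⟩
    rintro rfl
    exact hyz hu.2
  have hineq := h.clique_inequality hC.prop hy rfl rfl
  by_contra! h14
  set a : ℤ := (#(C ∩ G.neighborFinset y) : ℤ) with ha
  set c : ℤ := (#C : ℤ) with hc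
  have a1 : a ≤ 58 := by rw [ha]; exact_mod_cast h58
  have a2 : 14 ≤ a := by rw [ha]; exact_mod_cast h14
  have c1 : 146 ≤ c := by rw [hc]; exact_mod_cast hcard
  have hpos : 0 < 4 * a * (c - a + 3) := by
    have : 0 < c - a + 3 := by linarith
    positivity
  have := nonneg_of_mul_nonneg_right hineq hpos
  nlinarith [mul_nonneg (sub_nonneg.2 a1) (sub_nonneg.2 a2),
    mul_nonneg (sub_nonneg.2 c1) (sub_nonneg.2 a2)]

lemma sum_card_inter (h : G.IsSRGWith 23276 1330 372 58) (C : Finset V) :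
    ∑ y, (#(C ∩ G.neighborFinset y) : ℤ) = 1330 * #C := by
  have e : ∀ y, (#(C ∩ G.neighborFinset y) : ℤ) = ∑ u ∈ C, if G.Adj y u then 1 else 0 := by
    intro y
    simp [← filter_mem_eq_inter]
  simp only [e]
  rw [sum_comm, mul_comm, ← nsmul_eq_mul, ← sum_const]
  refine sum_congr rfl fun u _ ↦ ?_
  have := h.regular.degree_eq u
  rw [← card_neighborFinset_eq_degree, neighborFinset_eq_filter] at this
  simp [G.adj_comm _ u, this]

lemma sum_card_inter_sq (h : G.IsSRGWith 23276 1330 372 58) {C : Finset V}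
    (hC : G.IsClique (C : Set V)) :
    ∑ y, (#(C ∩ G.neighborFinset y) : ℤ) ^ 2 = 1330 * #C + 372 * (#C * (#C - 1)) := by
  have e : ∀ y, (#(C ∩ G.neighborFinset y) : ℤ) ^ 2
      = ∑ u ∈ C, ∑ v ∈ C, if G.Adj u y ∧ G.Adj v y then 1 else 0 := by
    intro y
    have : (#(C ∩ G.neighborFinset y) : ℤ) = ∑ u ∈ C, if G.Adj u y then 1 else 0 := by
      simp [← filter_mem_eq_inter, G.adj_comm]
    rw [this, sq, sum_mul_sum]
    refine sum_congr rfl fun u _ ↦ sum_congr rfl fun v _ ↦ ?_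
    by_cases h1 : G.Adj u y <;> by_cases h2 : G.Adj v y <;> simp [h1, h2]
  have e2 : ∀ u v, ∑ y, (if G.Adj u y ∧ G.Adj v y then (1 : ℤ) else 0)
      = #(G.neighborFinset u ∩ G.neighborFinset v) := by
    intro u v
    rw [neighborFinset_eq_filter, neighborFinset_eq_filter, ← filter_and]
    simp
  simp only [e]
  rw [sum_comm]
  have e3 : ∀ u ∈ C, ∑ y, ∑ v ∈ C, (if G.Adj u y ∧ G.Adj v y then (1 : ℤ) else 0)
      = 1330 + 372 * (#C - 1) := by
    intro u hu
    rw [sum_comm, ← add_sum_erase _ _ hu, e2, inter_self, card_neighborFinset_eq_degree,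
      h.regular.degree_eq]
    have : ∀ v ∈ C.erase u, ∑ y, (if G.Adj u y ∧ G.Adj v y then (1 : ℤ) else 0) = 372 := by
      intro v hv
      rw [e2, h.card_inter_of_adj (hC hu (mem_of_mem_erase hv) (ne_of_mem_erase hv).symm)]
      rfl
    rw [sum_congr rfl this, sum_const, nsmul_eq_mul, cast_card_erase_of_mem hu]
    push_cast
    ring
  rw [sum_congr rfl e3, sum_const, nsmul_eq_mul]
  ring

/-- Maximal cliques have fewer than `146` vertices. -/
lemma card_lt_of_maximal_isClique (h : G.IsSRGWith 23276 1330 372 58) {C : Finset V}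
    (hC : Maximal (fun s : Finset V ↦ G.IsClique (s : Set V)) C) : #C < 146 := by
  by_contra! hcard
  set d : V → ℤ := fun y ↦ (#(C ∩ G.neighborFinset y) : ℤ) with hd
  set c : ℤ := (#C : ℤ) with hc
  have c1 : 146 ≤ c := by rw [hc]; exact_mod_cast hcard
  have hin : ∀ y ∈ C, d y = c - 1 := by
    intro y hy
    have : C ∩ G.neighborFinset y = C.erase y := by
      ext v
      simp only [mem_inter, mem_neighborFinset, mem_erase]
      exact ⟨fun hv ↦ ⟨hv.2.ne', hv.1⟩, fun hv ↦ ⟨hv.2, hC.prop hy hv.2 hv.1.symm⟩⟩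
    rw [hd, hc]
    simp only [this, cast_card_erase_of_mem hy]
  have s1 : ∑ y ∈ Cᶜ, d y = 1330 * c - c * (c - 1) := by
    have := sum_add_sum_compl C d
    rw [sum_congr rfl hin, h.sum_card_inter C, sum_const, nsmul_eq_mul] at this
    linarith
  have s2 : ∑ y ∈ Cᶜ, d y ^ 2 = 1330 * c + 372 * (c * (c - 1)) - c * (c - 1) ^ 2 := by
    have := sum_add_sum_compl C (fun y ↦ d y ^ 2)
    rw [sum_congr rfl (fun y hy ↦ by rw [hin y hy]), h.sum_card_inter_sq hC.prop, sum_const,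
      nsmul_eq_mul] at this
    linarith
  have s0 : (#Cᶜ : ℤ) = 23276 - c := by
    rw [card_compl, h.card, Nat.cast_sub (h.card ▸ card_le_univ C)]
    rfl
  have b1 : ∑ y ∈ Cᶜ, d y ^ 2 ≤ 13 * ∑ y ∈ Cᶜ, d y := by
    rw [mul_sum]
    refine sum_le_sum fun y hy ↦ ?_
    have h13 : d y ≤ 13 := by
      simp only [hd]
      exact_mod_cast h.card_inter_neighborFinset_le hC hcard (mem_compl.1 hy)
    have h0 : 0 ≤ d y := by positivity
    nlinarith
  have b2 : 0 ≤ ∑ y ∈ Cᶜ, d y ^ 2 - 28 * ∑ y ∈ Cᶜ, d y + 196 * #Cᶜ := by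
    have : 0 ≤ ∑ y ∈ Cᶜ, (d y - 14) ^ 2 := sum_nonneg fun y _ ↦ sq_nonneg _
    refine this.trans_eq ?_
    rw [mul_sum, mul_comm (196 : ℤ), ← nsmul_eq_mul, ← sum_const, ← sum_sub_distrib,
      ← sum_add_distrib]
    exact sum_congr rfl fun y _ ↦ by ring
  rw [s1, s2] at b1 b2
  rw [s0] at b2
  have b3 : 1330 + 372 * (c - 1) - (c - 1) ^ 2 ≤ 13 * (1330 - (c - 1)) :=
    le_of_mul_le_mul_left (by linarith) (by linarith : 0 < c)
  rcases le_or_gt c 338 with c2 | c2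
  · nlinarith
  · have c3 : 339 ≤ c := c2
    nlinarith [mul_nonneg (sub_nonneg.2 c3) (sub_nonneg.2 c3),
      mul_nonneg (sub_nonneg.2 c3) (mul_nonneg (sub_nonneg.2 c3) (sub_nonneg.2 c3))]

lemma card_localBall (h : G.IsSRGWith 23276 1330 372 58) {x z : V} (hz : G.Adj x z) :
    #(localBall G x z) = 373 := by
  rw [localBall, card_insert_of_notMem (by simp), h.card_inter_of_adj hz]

lemma card_localBall_inter_le (h : G.IsSRGWith 23276 1330 372 58) {x z t : V} (hz : G.Adj x z)
    (ht : G.Adj x t) (hne : z ≠ t) (hzt : ¬ G.Adj z t) :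
    #(localBall G x z ∩ localBall G x t) ≤ 57 := by
  have hx : x ∈ G.neighborFinset z ∩ G.neighborFinset t := by simp [hz.symm, ht.symm]
  have hcard := card_erase_of_mem hx
  rw [h.card_inter_of_not_adj hne hzt] at hcard
  rw [← show _ = 57 from hcard]
  refine card_le_card fun u hu ↦ ?_
  have hzt' : ¬ G.Adj t z := fun h' ↦ hzt h'.symm
  simp only [localBall, mem_inter, mem_insert, mem_neighborFinset, mem_erase] at hu ⊢
  rcases hu with ⟨rfl | ⟨h1, h2⟩, rfl | ⟨h3, h4⟩⟩
  · exact absurd rfl hne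
  · exact absurd h4 hzt'
  · exact absurd h2 hzt
  · exact ⟨h1.ne', h2, h4⟩

lemma card_localBall_sdiff (h : G.IsSRGWith 23276 1330 372 58) {x z : V} {T : Finset V}
    (hT : IsLocalCoclique G x (insert z T)) (hz : z ∉ T) :
    373 ≤ #(localBall G x z \ T.biUnion (localBall G x)) + #T * 57 := by
  have hxz := hT.1 z (mem_insert_self z T)
  rw [← h.card_localBall hxz, ← card_sdiff_add_card_inter _ (T.biUnion (localBall G x)),
    inter_biUnion]
  gcongr
  refine card_biUnion_le_card_mul _ _ _ fun t ht ↦ ?_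
  refine h.card_localBall_inter_le hxz (hT.1 t (mem_insert_of_mem ht)) ?_
    (hT.2 z (mem_insert_self z T) t (mem_insert_of_mem ht))
  rintro rfl
  exact hz ht

lemma card_biUnion_localBall (h : G.IsSRGWith 23276 1330 372 58) {x : V} (T : Finset V)
    (hT : IsLocalCoclique G x T) :
    (373 * #T : ℤ) * 2 ≤ #(T.biUnion (localBall G x)) * 2 + 57 * (#T * (#T - 1)) := by
  induction T using Finset.induction_on with
  | empty => simp
  | insert z T hz ih =>
    have h1 := ih (hT.mono (subset_insert z T))
    have h2 := h.card_localBall_sdiff hT hz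
    have h3 : #((insert z T).biUnion (localBall G x))
        = #(localBall G x z \ T.biUnion (localBall G x)) + #(T.biUnion (localBall G x)) := by
      rw [biUnion_insert, card_sdiff_add_card]
    rw [h3, card_insert_of_notMem hz]
    zify at h2
    push_cast
    linarith

lemma card_localCoclique_le (h : G.IsSRGWith 23276 1330 372 58) {x : V} {T : Finset V}
    (hT : IsLocalCoclique G x T) : #T ≤ 5 := by
  by_contra! h6
  obtain ⟨S, hST, hS⟩ := exists_subset_card_eq (show 6 ≤ #T from h6)
  have h1 := h.card_biUnion_localBall S (hT.mono hST)
  have h2 : #(S.biUnion (localBall G x)) ≤ 1330 := by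
    rw [← h.regular.degree_eq x, ← card_neighborFinset_eq_degree]
    refine card_le_card (biUnion_subset.2 fun t ht ↦ ?_)
    rw [localBall, insert_subset_iff]
    exact ⟨by simpa using hT.1 t (hST ht), inter_subset_left⟩
  rw [hS] at h1
  zify at h2
  norm_num at h1
  linarith

/-- The claw bound: there is a clique with at least `146` vertices. -/
lemma exists_large_isClique (h : G.IsSRGWith 23276 1330 372 58) :
    ∃ K : Finset V, G.IsClique (K : Set V) ∧ 146 ≤ #K := by
  classical
  obtain ⟨x⟩ : Nonempty V := Fintype.card_pos_iff.1 (by rw [h.card]; norm_num)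
  obtain ⟨S, hS, hmax⟩ := exists_max_image
    (univ.filter fun T : Finset V ↦ IsLocalCoclique G x T) Finset.card
    ⟨∅, mem_filter.2 ⟨mem_univ _, by simp [IsLocalCoclique]⟩⟩
  simp only [mem_filter, mem_univ, true_and] at hS hmax
  obtain ⟨z, hz⟩ : S.Nonempty := by
    obtain ⟨y, hy⟩ : (G.neighborFinset x).Nonempty := by
      rw [← card_pos, card_neighborFinset_eq_degree, h.regular.degree_eq]
      norm_num
    rw [mem_neighborFinset] at hy
    have := hmax {y} ⟨by simp [hy], by simp⟩
    rw [card_singleton] at this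
    exact card_pos.1 this
  have hS5 := h.card_localCoclique_le hS
  set T := S.erase z with hT
  have hTcard : #T + 1 = #S := card_erase_add_one hz
  have hins : insert z T = S := insert_erase hz
  set P := localBall G x z \ T.biUnion (localBall G x) with hP
  have hPcard : 145 ≤ #P := by
    have := h.card_localBall_sdiff (hins ▸ hS) (notMem_erase z S)
    rw [← hT, ← hP] at this
    omega
  have hPx : ∀ u ∈ P, G.Adj x u := by
    intro u hu
    have := (mem_sdiff.1 hu).1
    simp only [localBall, mem_insert, mem_inter, mem_neighborFinset] at this
    rcases this with rfl | h1
    · exact hS.1 _ hz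
    · exact h1.1
  have hPT : ∀ u ∈ P, ∀ t ∈ T, u ≠ t ∧ ¬ G.Adj u t := by
    intro u hu t ht
    have := (mem_sdiff.1 hu).2
    simp only [localBall, mem_biUnion, mem_insert, mem_inter, mem_neighborFinset, not_exists,
      not_and, not_or] at this
    have := this t ht
    exact ⟨this.1, fun h' ↦ this.2 (hPx u hu) h'.symm⟩
  have hTco := hS.mono (erase_subset z S)
  have hPclique : G.IsClique (P : Set V) := by
    intro u hu w hw huw
    rw [mem_coe] at hu hw
    by_contra hadj
    have hco : IsLocalCoclique G x (insert u (insert w T)) := by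
      constructor
      · intro t ht
        simp only [mem_insert] at ht
        rcases ht with rfl | rfl | ht
        exacts [hPx _ hu, hPx _ hw, hTco.1 t ht]
      · intro s hs t ht
        simp only [mem_insert] at hs ht
        rcases hs with rfl | rfl | hs <;> rcases ht with rfl | rfl | ht
        · exact G.irrefl
        · exact hadj
        · exact (hPT _ hu t ht).2
        · exact fun h' ↦ hadj h'.symm
        · exact G.irrefl
        · exact (hPT _ hw t ht).2
        · exact fun h' ↦ (hPT _ hu s hs).2 h'.symm
        · exact fun h' ↦ (hPT _ hw s hs).2 h'.symm
        · exact hTco.2 s hs t ht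
    have hle := hmax _ hco
    have hwT : w ∉ T := fun h' ↦ (hPT w hw w h').1 rfl
    have huT : u ∉ insert w T := by
      rw [mem_insert, not_or]
      exact ⟨huw, fun h' ↦ (hPT u hu u h').1 rfl⟩
    rw [card_insert_of_notMem huT, card_insert_of_notMem hwT] at hle
    omega
  refine ⟨insert x P, ?_, ?_⟩
  · rw [coe_insert, isClique_insert]
    exact ⟨hPclique, fun b hb _ ↦ hPx b hb⟩
  · rw [card_insert_of_notMem fun hx ↦ (hPx x hx).ne rfl]
    omega

end SimpleGraph.IsSRGWith

/-- There is no strongly regular graph with parameters `(23276, 1330, 372, 58)`. -/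
theorem no_srg_23276_1330_372_58 {V : Type*} [Fintype V] [DecidableEq V]
    (G : SimpleGraph V) [DecidableRel G.Adj] :
    ¬ G.IsSRGWith 23276 1330 372 58 := by
  intro h
  obtain ⟨K, hK, hcard⟩ := h.exists_large_isClique
  obtain ⟨C, hKC, hC⟩ := Finite.exists_le_maximal
    (p := fun s : Finset V ↦ G.IsClique (s : Set V)) hK
  have := h.card_lt_of_maximal_isClique hC
  have := Finset.card_le_card hKC
  omega
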